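/- arXiv:2305.05979 — 3 statements merged into one kernel-verified Lean document; each statement's English description precedes it below -/
import Mathlib

section
/- Let n be a natural number, R > 0, and let α, β > 0 satisfy J_n'(α) = 0, J_n'(β) = 0 and α ≠ β. Then the Bessel functions J_n(α r / R) and J_n(β r / R) are orthogonal on [0, R] with weight r: ∫_0^R r · J_n(α r / R) · J_n(β r / R) dr = 0. -/
/-- The Bessel function of the first kind of (natural) order `n`. -/
noncomputable def besselJ (n : ℕ) (ρ : ℝ) : ℝ :=
  ∑' m : ℕ, ((-1 : ℝ) ^ m / (m.factorial * (n + m).factorial)) * (ρ / 2) ^ (n + 2 * m)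

noncomputable def bC (n k m : ℕ) : ℝ :=
  ((n + 2 * m : ℕ) : ℝ) ^ k * ((-1 : ℝ) ^ m / (m.factorial * (n + m).factorial))

noncomputable def bF (n k : ℕ) (x : ℝ) : ℝ := ∑' m : ℕ, bC n k m * (x / 2) ^ (n + 2 * m)

lemma abs_bC (n k m : ℕ) : |bC n k m| ≤ k.factorial * Real.exp 1 ^ (n + 2 * m) / m.factorial := by
  have h1 : ((n + 2 * m : ℕ) : ℝ) ^ k ≤ k.factorial * Real.exp 1 ^ (n + 2 * m) := by
    have := Real.pow_div_factorial_le_exp ((n + 2 * m : ℕ) : ℝ) (by positivity) k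
    rw [div_le_iff₀ (by positivity)] at this
    rw [← Real.exp_nat_mul, mul_one]
    linarith
  have h2 : (1 : ℝ) ≤ (n + m).factorial := by exact_mod_cast Nat.factorial_pos _
  have hm : (0 : ℝ) < m.factorial := by positivity
  unfold bC
  rw [abs_mul, abs_div, abs_pow, abs_pow, abs_neg, abs_one, one_pow, abs_mul,
    Nat.abs_cast, Nat.abs_cast, Nat.abs_cast, mul_one_div]
  apply div_le_div₀ (by positivity) h1 hm
  nlinarith

lemma sum_bound (n k : ℕ) (M : ℝ) :
    Summable (fun m : ℕ => k.factorial * Real.exp 1 ^ (n + 2 * m) / m.factorial * M ^ (n + 2 * m)) := by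
  have := (Real.summable_pow_div_factorial ((Real.exp 1 * M) ^ 2)).mul_left
    (k.factorial * (Real.exp 1 * M) ^ n)
  refine this.congr fun m => ?_
  rw [← pow_mul, pow_add, pow_add, mul_pow, mul_pow]
  ring

lemma bF_summable (n k : ℕ) (x : ℝ) : Summable (fun m : ℕ => bC n k m * (x / 2) ^ (n + 2 * m)) := by
  refine Summable.of_norm_bounded (sum_bound n k |x / 2|) fun m => ?_
  rw [Real.norm_eq_abs, abs_mul, abs_pow]
  gcongr
  exact abs_bC n k m

lemma bF_diff (n k : ℕ) (x : ℝ) : ∃ d, HasDerivAt (bF n k) d x ∧ x * d = bF n (k + 1) x := by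
  set M : ℝ := |x| + 1
  have hM : 1 ≤ M := by simp [M]
  have key := hasDerivAt_tsum_of_isPreconnected (t := Metric.ball (0 : ℝ) M) (y₀ := x) (y := x)
    (g := fun m y => bC n k m * (y / 2) ^ (n + 2 * m))
    (g' := fun m y => bC n k m * (((n + 2 * m : ℕ) : ℝ) * (y / 2) ^ (n + 2 * m - 1) * (1 / 2)))
    (sum_bound n (k + 1) M) Metric.isOpen_ball (convex_ball _ _).isPreconnected
    (fun m y _ => by
      exact (((hasDerivAt_id y).div_const 2).pow (n + 2 * m)).const_mul (bC n k m))
    (fun m y hy => by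
      have hy : |y| < M := by simpa using hy
      have e : bC n k m * (((n + 2 * m : ℕ) : ℝ) * (y / 2) ^ (n + 2 * m - 1) * (1 / 2))
        = bC n (k + 1) m * ((y / 2) ^ (n + 2 * m - 1) * (1 / 2)) := by
        unfold bC; ring
      rw [e, Real.norm_eq_abs, abs_mul]
      refine mul_le_mul (abs_bC _ _ _) ?_ (abs_nonneg _) (by positivity)
      rw [abs_mul, abs_pow]
      have h1 : |y / 2| ≤ M := by
        rw [abs_div, abs_two]; linarith [abs_nonneg y]
      have h2 : |y / 2| ^ (n + 2 * m - 1) ≤ M ^ (n + 2 * m) :=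
        (pow_le_pow_left₀ (abs_nonneg _) h1 _).trans (pow_le_pow_right₀ hM (by omega))
      have h3 : |(1 / 2 : ℝ)| ≤ 1 := by norm_num [abs_le]
      calc _ ≤ M ^ (n + 2 * m) * 1 := mul_le_mul h2 h3 (abs_nonneg _) (by positivity)
        _ = _ := mul_one _)
    (by simp [M]) (bF_summable n k x) (by simp [M])
  refine ⟨_, key, ?_⟩
  rw [← tsum_mul_left]
  unfold bF
  congr 1
  ext m
  rcases Nat.eq_zero_or_pos (n + 2 * m) with h | h
  · simp [bC, h]
  · obtain ⟨p, hp⟩ := Nat.exists_eq_add_of_lt h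
    have hp : n + 2 * m = p + 1 := by omega
    unfold bC
    rw [hp, Nat.add_sub_cancel]
    ring

lemma bF_zero (n : ℕ) : bF n 0 = besselJ n := by
  ext x; simp [bF, bC, besselJ]

lemma bF_two (n : ℕ) (x : ℝ) : bF n 2 x = (n ^ 2 - x ^ 2) * bF n 0 x := by
  have h0 := bF_summable n 0 x
  have h2 := bF_summable n 2 x
  have hs : Summable (fun m : ℕ => (bC n 2 m - n ^ 2 * bC n 0 m) * (x / 2) ^ (n + 2 * m)) := by
    refine (h2.sub (h0.mul_left ((n : ℝ) ^ 2))).congr fun m => ?_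
    ring
  have e1 : bF n 2 x - n ^ 2 * bF n 0 x =
      ∑' m : ℕ, (bC n 2 m - n ^ 2 * bC n 0 m) * (x / 2) ^ (n + 2 * m) := by
    unfold bF
    rw [← tsum_mul_left, ← h2.tsum_sub (h0.mul_left _)]
    congr 1; ext m; ring
  have e2 : ∑' m : ℕ, (bC n 2 m - n ^ 2 * bC n 0 m) * (x / 2) ^ (n + 2 * m)
      = - x ^ 2 * bF n 0 x := by
    rw [hs.tsum_eq_zero_add]
    unfold bF
    rw [← tsum_mul_left]
    have : (bC n 2 0 - n ^ 2 * bC n 0 0) * (x / 2) ^ (n + 2 * 0) = 0 := by simp [bC]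
    rw [this, zero_add]
    congr 1; ext m
    have f1 : ((m + 1).factorial : ℝ) = (m + 1) * m.factorial := by
      rw [Nat.factorial_succ]; push_cast; ring
    have f2 : ((n + (m + 1)).factorial : ℝ) = (n + m + 1) * (n + m).factorial := by
      rw [← add_assoc, Nat.factorial_succ]; push_cast; ring
    have p1 : (m.factorial : ℝ) ≠ 0 := by positivity
    have p2 : ((n + m).factorial : ℝ) ≠ 0 := by positivity
    have p3 : (m + 1 : ℝ) ≠ 0 := by positivity
    have p4 : (n + m + 1 : ℝ) ≠ 0 := by positivity
    have f3 : (x / 2) ^ (n + 2 * (m + 1)) = (x / 2) ^ (n + 2 * m) * (x / 2) ^ 2 := by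
      rw [← pow_add]; congr 1
    have f4 : bC n 2 (m + 1) - n ^ 2 * bC n 0 (m + 1) = -4 * bC n 0 m := by
      unfold bC
      rw [f1, f2, pow_succ (-1 : ℝ) m]
      push_cast
      field_simp
      ring
    rw [f3, f4]
    ring
  linarith

lemma bF_one_of (n : ℕ) (x : ℝ) (h : deriv (besselJ n) x = 0) : bF n 1 x = 0 := by
  obtain ⟨d, hd, he⟩ := bF_diff n 0 x
  rw [bF_zero] at hd
  rw [hd.deriv] at h
  rw [← he, h, mul_zero]

theorem besselJ_orthogonal (n : ℕ) (R : ℝ) (hR : 0 < R) (α β : ℝ)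
    (hα : 0 < α) (hβ : 0 < β)
    (hα' : deriv (besselJ n) α = 0) (hβ' : deriv (besselJ n) β = 0) (hne : α ≠ β) :
    ∫ r in (0 : ℝ)..R, r * besselJ n (α * r / R) * besselJ n (β * r / R) = 0 := by
  rw [← bF_zero]
  have hc : ∀ k, Continuous (bF n k) := fun k =>
    continuous_iff_continuousAt.2 fun x => (bF_diff n k x).choose_spec.1.continuousAt
  have c0 := hc 0
  have c1 := hc 1
  have z0 : bF n 1 0 = 0 := by
    obtain ⟨d, hd, he⟩ := bF_diff n 0 0
    rw [← he, zero_mul]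
  have lin : ∀ a r : ℝ, HasDerivAt (fun r : ℝ => a * r / R) (a / R) r := fun a r => by
    simpa using ((hasDerivAt_id r).const_mul a).div_const R
  have ftc := intervalIntegral.integral_eq_sub_of_hasDerivAt_of_le (a := 0) (b := R) hR.le
    (f := fun r => bF n 0 (α * r / R) * bF n 1 (β * r / R) - bF n 1 (α * r / R) * bF n 0 (β * r / R))
    (f' := fun r => ((α / R) ^ 2 - (β / R) ^ 2) * (r * bF n 0 (α * r / R) * bF n 0 (β * r / R)))
    (by fun_prop)
    (fun r hr => by
      obtain ⟨d0, hd0, he0⟩ := bF_diff n 0 (α * r / R)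
      obtain ⟨d1, hd1, he1⟩ := bF_diff n 1 (α * r / R)
      obtain ⟨g0, hg0, hf0⟩ := bF_diff n 0 (β * r / R)
      obtain ⟨g1, hg1, hf1⟩ := bF_diff n 1 (β * r / R)
      have A0 := hd0.comp r (lin α r)
      have A1 := hd1.comp r (lin α r)
      have B0 := hg0.comp r (lin β r)
      have B1 := hg1.comp r (lin β r)
      refine ((A0.mul B1).sub (A1.mul B0)).congr_deriv ?_
      have hr0 : r ≠ 0 := hr.1.ne'
      norm_num at he0 he1 hf0 hf1
      rw [bF_two] at he1 hf1
      apply mul_left_cancel₀ hr0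
      simp only [Function.comp_apply]
      linear_combination bF n 1 (β * r / R) * he0 + bF n 0 (α * r / R) * hf1
        - bF n 0 (β * r / R) * he1 - bF n 1 (α * r / R) * hf0)
    (by apply Continuous.intervalIntegrable; fun_prop)
  rw [intervalIntegral.integral_const_mul] at ftc
  have ea : α * R / R = α := by field_simp
  have eb : β * R / R = β := by field_simp
  simp only [ea, eb, bF_one_of n α hα', bF_one_of n β hβ', mul_zero, zero_div, z0, zero_mul,
    sub_zero] at ftc
  rcases mul_eq_zero.1 ftc with h | h
  · exfalso
    apply hne
    have h' : (α / R) ^ 2 = (β / R) ^ 2 := by linarith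
    have := (pow_left_inj₀ (by positivity) (by positivity) two_ne_zero).1 h'
    field_simp at this
    exact this
  · exact h
end

section
/- Let n be a natural number, R > 0, and let α > 0 satisfy J_n'(α) = 0. Then the weighted L² norm of the radial eigenfunction is given explicitly by ∫_0^R r · J_n(α r / R)² dr = (R²/2) · (1 − (n/α)²) · J_n(α)². -/
noncomputable def bG (k : ℕ) (t : ℝ) : ℝ :=
  ∑' m : ℕ, ((-1 : ℝ) ^ m / (m.factorial * (k + m).factorial)) * t ^ m

lemma bG_coeff (k m : ℕ) :
    |((-1 : ℝ) ^ m / (m.factorial * (k + m).factorial))| ≤ 1 / m.factorial := by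
  have h1 : (0:ℝ) < m.factorial := by positivity
  have h2 : (1:ℝ) ≤ (k + m).factorial := by exact_mod_cast Nat.succ_le_of_lt (Nat.factorial_pos _)
  rw [abs_div, abs_pow, abs_neg, abs_one, one_pow, abs_of_pos (by positivity)]
  apply one_div_le_one_div_of_le h1
  nlinarith

lemma bG_summable (k : ℕ) (t : ℝ) :
    Summable fun m : ℕ => ((-1 : ℝ) ^ m / (m.factorial * (k + m).factorial)) * t ^ m := by
  refine Summable.of_norm_bounded (Real.summable_pow_div_factorial |t|) fun m => ?_
  rw [Real.norm_eq_abs, abs_mul, abs_pow]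
  calc _ ≤ 1 / (m.factorial : ℝ) * |t| ^ m := by gcongr; exact bG_coeff k m
    _ = _ := by ring

lemma bG_hasDerivAt (k : ℕ) (t : ℝ) : HasDerivAt (bG k) (-bG (k+1) t) t := by
  set r : ℝ := |t| + 1
  have hu : Summable fun m : ℕ => 1 / (m.factorial : ℝ) * (m * r ^ (m - 1)) := by
    rw [← summable_nat_add_iff 1]
    refine (Real.summable_pow_div_factorial r).congr fun m => ?_
    rw [Nat.factorial_succ]
    push_cast
    field_simp
  have h := hasDerivAt_tsum_of_isPreconnected (t := Metric.ball (0:ℝ) r)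
    (g := fun m x => ((-1 : ℝ) ^ m / (m.factorial * (k + m).factorial)) * x ^ m)
    (g' := fun m x => ((-1 : ℝ) ^ m / (m.factorial * (k + m).factorial)) * (m * x ^ (m-1)))
    (y₀ := 0) (y := t) hu Metric.isOpen_ball (convex_ball _ _).isPreconnected
    (fun m x _ => (hasDerivAt_pow m x).const_mul _)
    (fun m x hx => by
      have hx' : |x| ≤ r := by simpa using (Metric.mem_ball.1 hx).le
      rw [Real.norm_eq_abs, abs_mul, abs_mul, abs_pow, Nat.abs_cast]
      gcongr
      exact bG_coeff k m)
    (by simp; positivity) (bG_summable k 0) (by simp [r])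
  have e : (∑' m : ℕ, ((-1 : ℝ) ^ m / (m.factorial * (k + m).factorial)) * (m * t ^ (m-1)))
      = -bG (k+1) t := by
    rw [tsum_eq_zero_add', bG, ← tsum_neg]
    · simp only [Nat.cast_zero, zero_mul, mul_zero, zero_add]
      refine tsum_congr fun m => ?_
      rw [Nat.factorial_succ, show k + (m+1) = k + 1 + m by ring, Nat.add_sub_cancel]
      push_cast
      field_simp
      ring
    · refine (bG_summable (k+1) t).neg.congr fun m => ?_
      rw [Nat.factorial_succ, show k + (m+1) = k + 1 + m by ring, Nat.add_sub_cancel]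
      push_cast
      field_simp
      ring
  rw [← e]
  exact h

lemma bG_rec (k : ℕ) (t : ℝ) : t * bG (k+2) t = (k+1) * bG (k+1) t - bG k t := by
  have hs := ((bG_summable (k+1) t).mul_left ((k:ℝ)+1)).sub (bG_summable k t)
  simp only [bG]
  rw [← tsum_mul_left, ← tsum_mul_left, ← Summable.tsum_sub
    ((bG_summable (k+1) t).mul_left ((k:ℝ)+1)) (bG_summable k t), hs.tsum_eq_zero_add]
  have h0 : ((k:ℝ)+1) * (((-1 : ℝ) ^ 0 / ((0:ℕ).factorial * (k + 1 + 0).factorial)) * t ^ 0)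
      - ((-1 : ℝ) ^ 0 / ((0:ℕ).factorial * (k + 0).factorial)) * t ^ 0 = 0 := by
    simp only [Nat.add_zero, Nat.factorial_succ k]
    push_cast
    field_simp
    ring
  rw [h0, zero_add]
  refine tsum_congr fun m => ?_
  rw [show k + 2 + m = (k + m + 1) + 1 by ring, show k + 1 + (m+1) = (k+m+1)+1 by ring,
    show k + (m+1) = k + m + 1 by ring, Nat.factorial_succ (k+m+1), Nat.factorial_succ m]
  push_cast
  field_simp
  ring

lemma besselJ_eq (n : ℕ) (x : ℝ) : besselJ n x = (x/2)^n * bG n ((x/2)^2) := by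
  rw [besselJ, bG, ← tsum_mul_left]
  refine tsum_congr fun m => ?_
  rw [pow_add, pow_mul]; ring

lemma bGc (k : ℕ) (x : ℝ) :
    HasDerivAt (fun x => bG k ((x/2)^2)) (-bG (k+1) ((x/2)^2) * (x/2)) x := by
  have h : HasDerivAt (fun x : ℝ => (x/2)^2) (x/2) x := by
    have := ((hasDerivAt_id x).div_const 2).pow 2
    exact this.congr_deriv (by simp; try ring)
  exact (bG_hasDerivAt k _).comp x h

lemma half_pow (n : ℕ) (x : ℝ) (hx : x ≠ 0) :
    HasDerivAt (fun x : ℝ => (x/2)^n) (n * (x/2)^n / x) x := by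
  have := ((hasDerivAt_id x).div_const 2).pow n
  refine HasDerivAt.congr_deriv this ?_
  cases n with
  | zero => simp
  | succ n => simp [pow_succ]; field_simp

noncomputable def bTh (n : ℕ) (x : ℝ) : ℝ :=
  (x/2)^n * (n * bG n ((x/2)^2) - x^2/2 * bG (n+1) ((x/2)^2))

lemma besselJ_deriv (n : ℕ) (x : ℝ) (hx : x ≠ 0) : HasDerivAt (besselJ n) (bTh n x / x) x := by
  rw [show besselJ n = fun x => (x/2)^n * bG n ((x/2)^2) from funext (besselJ_eq n)]
  refine HasDerivAt.congr_deriv ((half_pow n x hx).mul (bGc n x)) ?_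
  rw [bTh]; field_simp; ring

lemma bTh_deriv (n : ℕ) (x : ℝ) (hx : x ≠ 0) :
    HasDerivAt (bTh n) ((n^2 - x^2) * besselJ n x / x) x := by
  have h := (half_pow n x hx).mul (((bGc n x).const_mul (n:ℝ)).sub
    ((((hasDerivAt_id x).pow 2).div_const 2).mul (bGc (n+1) x)))
  refine HasDerivAt.congr_deriv h ?_
  have hr := bG_rec n ((x/2)^2)
  rw [besselJ_eq]
  simp only [Pi.mul_apply, Pi.sub_apply, Pi.pow_apply, id, show n + 1 + 1 = n + 2 from rfl]
  push_cast
  field_simp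
  ring_nf at hr ⊢
  linear_combination (4 * x^2) * hr

lemma bG_cont (k : ℕ) : Continuous (bG k) :=
  continuous_iff_continuousAt.2 fun t => (bG_hasDerivAt k t).continuousAt

lemma besselJ_cont (n : ℕ) : Continuous (besselJ n) := by
  rw [show besselJ n = fun x => (x/2)^n * bG n ((x/2)^2) from funext (besselJ_eq n)]
  have := bG_cont n
  fun_prop

lemma bTh_cont (n : ℕ) : Continuous (bTh n) := by
  unfold bTh
  have := bG_cont n
  have := bG_cont (n+1)
  fun_prop

noncomputable def bE (n : ℕ) (x : ℝ) : ℝ := bTh n x ^ 2 / 2 + (x^2 - n^2) * besselJ n x ^ 2 / 2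

lemma bE_deriv (n : ℕ) (x : ℝ) (hx : x ≠ 0) : HasDerivAt (bE n) (x * besselJ n x ^ 2) x := by
  have h := (((bTh_deriv n x hx).pow 2).div_const 2).add
    (((((hasDerivAt_id x).pow 2).sub_const ((n:ℝ)^2)).mul ((besselJ_deriv n x hx).pow 2)).div_const 2)
  refine HasDerivAt.congr_deriv h ?_
  simp only [Pi.pow_apply, id]
  push_cast
  field_simp
  ring

lemma bE_cont (n : ℕ) : Continuous (bE n) := by
  unfold bE
  have := besselJ_cont n
  have := bTh_cont n
  fun_prop

lemma bE_zero (n : ℕ) : bE n 0 = 0 := by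
  rcases Nat.eq_zero_or_pos n with h | h
  · subst h; simp [bE, bTh]
  · simp [bE, bTh, besselJ_eq, h.ne']

/-- The weighted `L²` norm of the radial eigenfunction: if `α > 0` satisfies
`J_n'(α) = 0`, then `∫_0^R r J_n(αr/R)² dr = (R²/2)(1 − (n/α)²) J_n(α)²`. -/
theorem besselJ_weighted_norm (n : ℕ) (R : ℝ) (hR : 0 < R) (α : ℝ) (hα : 0 < α)
    (hα' : deriv (besselJ n) α = 0) :
    ∫ r in (0 : ℝ)..R, r * (besselJ n (α * r / R)) ^ 2
      = (R ^ 2 / 2) * (1 - ((n : ℝ) / α) ^ 2) * (besselJ n α) ^ 2 := by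
  have hJ := besselJ_cont n
  have hE := bE_cont n
  have hT : bTh n α = 0 := by
    have := (besselJ_deriv n α hα.ne').deriv
    rw [hα'] at this
    field_simp at this
    linarith
  rw [intervalIntegral.integral_eq_sub_of_hasDerivAt_of_le
    (f := fun r => (R/α)^2 * bE n (α * r / R)) hR.le]
  · rw [mul_zero, zero_div, bE_zero, mul_div_cancel_right₀ _ hR.ne', bE, hT]
    field_simp
    ring
  · exact Continuous.continuousOn (by fun_prop)
  · intro r hr
    have hr0 : 0 < r := hr.1
    have h1 : HasDerivAt (fun r : ℝ => α * r / R) (α / R) r := by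
      simpa using ((hasDerivAt_id r).const_mul α).div_const R
    have h2 := ((bE_deriv n (α * r / R) (by positivity)).comp r h1).const_mul ((R/α)^2)
    refine HasDerivAt.congr_deriv h2 ?_
    field_simp
  · exact Continuous.intervalIntegrable (by fun_prop) _ _
end

section
/- Let R > 0, let n, n' be natural numbers, let α > 0 satisfy J_n'(α) = 0 and α' > 0 satisfy J_{n'}'(α') = 0. If (n, α) ≠ (n', α'), then ∫_0^R ∫_0^{2π} r · J_n(α r / R) · J_{n'}(α' r / R) · e^{i(n − n')θ} dθ dr = 0. Moreover, if n + n' ≥ 1 (for any such α, α'), then ∫_0^R ∫_0^{2π} r · J_n(α r / R) · J_{n'}(α' r / R) · e^{i(n + n')θ} dθ dr = 0. In other words, the complex eigenfunctions φ^c_{n,α}(r,θ) = J_n(α r / R) e^{inθ} and their conjugates φ^s_{n,α} = J_n(α r / R) e^{−inθ} form an orthogonal system with weight r on [0,R] × [0,2π]. -/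
noncomputable def bS (n : ℕ) (a : ℕ → ℝ) (x : ℝ) : ℝ := ∑' m : ℕ, a m * (x / 2) ^ (n + 2 * m)

def bGood (n : ℕ) (a : ℕ → ℝ) : Prop := ∀ r : ℝ, 0 ≤ r → Summable (fun m => |a m| * r ^ (n + 2 * m))

lemma bGood_mul {n : ℕ} {a : ℕ → ℝ} (h : bGood n a) :
    bGood n (fun m => ((n + 2 * m : ℕ) : ℝ) * a m) := by
  intro r hr
  refine Summable.of_nonneg_of_le (fun m => by positivity) (fun m => ?_) (h (2 * r) (by positivity))
  have h2 : ((n + 2 * m : ℕ) : ℝ) ≤ 2 ^ (n + 2 * m) := by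
    exact_mod_cast Nat.lt_two_pow_self.le
  rw [abs_mul, Nat.abs_cast, mul_pow]
  calc _ = ((n + 2 * m : ℕ) : ℝ) * (|a m| * r ^ (n + 2 * m)) := by ring
    _ ≤ 2 ^ (n + 2 * m) * (|a m| * r ^ (n + 2 * m)) := by gcongr
    _ = _ := by ring

lemma bGood_summable {n : ℕ} {a : ℕ → ℝ} (h : bGood n a) (x : ℝ) :
    Summable (fun m => a m * (x / 2) ^ (n + 2 * m)) := by
  refine Summable.of_norm ?_
  refine (h |x / 2| (abs_nonneg _)).congr (fun m => ?_)
  rw [Real.norm_eq_abs, abs_mul, abs_pow]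

lemma bS_deriv {n : ℕ} {a : ℕ → ℝ} (h : bGood n a) (x : ℝ) :
    ∃ d, HasDerivAt (bS n a) d x ∧
      x * d = bS n (fun m => ((n + 2 * m : ℕ) : ℝ) * a m) x := by
  set r : ℝ := |x| + 1 with hr
  have hr1 : 1 ≤ r := by have := abs_nonneg x; linarith
  have hd : HasDerivAt (bS n a)
      (∑' m : ℕ, a m * (((n + 2 * m : ℕ) : ℝ) * (x / 2) ^ (n + 2 * m - 1) * (1 / 2))) x := by
    refine hasDerivAt_tsum_of_isPreconnected (t := Metric.ball (0:ℝ) r) (y₀ := x)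
      (g := fun m y => a m * (y / 2) ^ (n + 2 * m))
      (g' := fun m y => a m * (((n + 2 * m : ℕ) : ℝ) * (y / 2) ^ (n + 2 * m - 1) * (1 / 2)))
      (bGood_mul h r (by linarith))
      Metric.isOpen_ball (convex_ball _ _).isPreconnected ?_ ?_ ?_ (bGood_summable h x) ?_
    · intro m y _
      exact (((hasDerivAt_id y).div_const 2).pow (n + 2 * m)).const_mul (a m)
    · intro m y hy
      have hy' : |y| < r := by simpa using hy
      have e1 : |y / 2| ^ (n + 2 * m - 1) ≤ r ^ (n + 2 * m) := by
        calc _ ≤ r ^ (n + 2 * m - 1) := by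
              gcongr
              rw [abs_div, abs_two]
              have := abs_nonneg y
              linarith
          _ ≤ _ := pow_le_pow_right₀ hr1 (Nat.sub_le _ _)
      rw [Real.norm_eq_abs]
      simp only [abs_mul, abs_pow, Nat.abs_cast]
      have e2 : |(1 / 2 : ℝ)| ≤ 1 := by rw [abs_le]; constructor <;> norm_num
      calc _ = |a m| * ((n + 2 * m : ℕ) : ℝ) * (|y / 2| ^ (n + 2 * m - 1) * |(1 / 2 : ℝ)|) := by ring
        _ ≤ |a m| * ((n + 2 * m : ℕ) : ℝ) * (r ^ (n + 2 * m) * 1) := by gcongr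
        _ = _ := by ring
    · simp [hr]
    · simp [hr]
  refine ⟨_, hd, ?_⟩
  rw [bS, ← tsum_mul_left]
  congr 1
  ext m
  rcases Nat.eq_zero_or_pos (n + 2 * m) with h0 | h0
  · simp [h0]
  · obtain ⟨k, hk⟩ := Nat.exists_eq_succ_of_ne_zero h0.ne'
    rw [hk, Nat.succ_sub_one, pow_succ]
    ring

noncomputable def bc (n m : ℕ) : ℝ := (-1 : ℝ) ^ m / (m.factorial * (n + m).factorial)

lemma bGood_bc (n : ℕ) : bGood n (bc n) := by
  intro r hr
  refine Summable.of_nonneg_of_le (fun m => by positivity) (fun m => ?_)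
    ((Real.summable_pow_div_factorial (r ^ 2)).mul_left (r ^ n))
  have h1 : (1 : ℝ) ≤ (n + m).factorial := by exact_mod_cast Nat.factorial_pos _
  have h2 : (0 : ℝ) < m.factorial := by exact_mod_cast Nat.factorial_pos _
  have : |bc n m| ≤ 1 / m.factorial := by
    rw [bc, abs_div, abs_pow, abs_neg, abs_one, one_pow, abs_of_nonneg (by positivity)]
    apply one_div_le_one_div_of_le h2
    nlinarith
  calc _ ≤ (1 / m.factorial) * r ^ (n + 2 * m) := by gcongr
    _ = _ := by rw [pow_add, pow_mul]; ring

lemma besselJ_eq_s7 (n : ℕ) : besselJ n = bS n (bc n) := rfl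

noncomputable def bP (n : ℕ) : ℝ → ℝ := bS n (fun m => ((n + 2 * m : ℕ) : ℝ) * bc n m)

lemma bJ_deriv (n : ℕ) (x : ℝ) : ∃ d, HasDerivAt (besselJ n) d x ∧ x * d = bP n x :=
  bS_deriv (bGood_bc n) x

lemma bc_succ (n m : ℕ) : ((m : ℝ) + 1) * (n + m + 1) * bc n (m + 1) = - bc n m := by
  have h2 : (m.factorial : ℝ) ≠ 0 := by exact_mod_cast (Nat.factorial_pos _).ne'
  have h3 : ((n + m).factorial : ℝ) ≠ 0 := by exact_mod_cast (Nat.factorial_pos _).ne'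
  have h4 : (n : ℝ) + m + 1 ≠ 0 := by positivity
  have h5 : (m : ℝ) + 1 ≠ 0 := by positivity
  rw [bc, bc, ← add_assoc, Nat.factorial_succ, Nat.factorial_succ, pow_succ]
  push_cast
  field_simp

lemma bP_deriv (n : ℕ) (x : ℝ) : ∃ d, HasDerivAt (bP n) d x ∧
    x * d = (n ^ 2 - x ^ 2) * besselJ n x := by
  obtain ⟨d, hd, e⟩ := bS_deriv (bGood_mul (bGood_bc n)) x
  refine ⟨d, hd, ?_⟩
  rw [e]
  have s1 := bGood_summable (bGood_mul (bGood_mul (bGood_bc n))) x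
  have s2 := bGood_summable (bGood_bc n) x
  have key : bS n (fun m => ((n + 2 * m : ℕ) : ℝ) * (((n + 2 * m : ℕ) : ℝ) * bc n m)) x
      - n ^ 2 * bS n (bc n) x = - x ^ 2 * bS n (bc n) x := by
    rw [bS, bS, ← tsum_mul_left, ← Summable.tsum_sub s1 (s2.mul_left _),
      ((s1.sub (s2.mul_left ((n : ℝ) ^ 2))).tsum_eq_zero_add), ← tsum_mul_left]
    have z : ∀ A B : ℝ, A = 0 → 0 + B = A + B := by intro A B h; rw [h]
    rw [← z]
    · rw [zero_add]
      congr 1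
      ext m
      have := bc_succ n m
      have e : (x / 2) ^ (n + 2 * (m + 1)) = (x / 2) ^ (n + 2 * m) * (x ^ 2 / 4) := by
        rw [mul_add, ← add_assoc, pow_add _ (n + 2 * m)]; ring
      rw [e]
      push_cast
      linear_combination ((x / 2) ^ (n + 2 * m) * x ^ 2) * this
    · push_cast; ring
  rw [besselJ_eq_s7]
  linarith

lemma b_radial (R : ℝ) (hR : 0 < R) (n : ℕ) (α α' : ℝ) (hα : 0 < α) (hα' : 0 < α')
    (h1 : deriv (besselJ n) α = 0) (h2 : deriv (besselJ n) α' = 0) (hne : α ≠ α') :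
    ∫ r in (0 : ℝ)..R, r * besselJ n (α * r / R) * besselJ n (α' * r / R) = 0 := by
  have cJ : Continuous (besselJ n) := by
    rw [continuous_iff_continuousAt]; intro x
    obtain ⟨d, hd, -⟩ := bJ_deriv n x; exact hd.continuousAt
  have cP : Continuous (bP n) := by
    rw [continuous_iff_continuousAt]; intro x
    obtain ⟨d, hd, -⟩ := bP_deriv n x; exact hd.continuousAt
  have P0 : bP n 0 = 0 := by
    obtain ⟨d, hd, e⟩ := bJ_deriv n 0; rw [← e, zero_mul]
  have Pα : bP n α = 0 := by
    obtain ⟨d, hd, e⟩ := bJ_deriv n α; rw [← e, ← hd.deriv, h1, mul_zero]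
  have Pα' : bP n α' = 0 := by
    obtain ⟨d, hd, e⟩ := bJ_deriv n α'; rw [← e, ← hd.deriv, h2, mul_zero]
  have main := intervalIntegral.integral_eq_sub_of_hasDerivAt_of_le (a := 0) (b := R)
    (f := fun r => bP n (α * r / R) * besselJ n (α' * r / R)
      - besselJ n (α * r / R) * bP n (α' * r / R))
    (f' := fun r => ((α' ^ 2 - α ^ 2) / R ^ 2) *
      (r * besselJ n (α * r / R) * besselJ n (α' * r / R))) hR.le
    (by fun_prop) (by
      intro r hr
      have hr0 : r ≠ 0 := hr.1.ne'
      have l : ∀ β : ℝ, HasDerivAt (fun r : ℝ => β * r / R) (β / R) r := by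
        intro β
        simpa using ((hasDerivAt_id r).const_mul β).div_const R
      obtain ⟨p, hp, ep⟩ := bP_deriv n (α * r / R)
      obtain ⟨p', hp', ep'⟩ := bP_deriv n (α' * r / R)
      obtain ⟨j, hj, ej⟩ := bJ_deriv n (α * r / R)
      obtain ⟨j', hj', ej'⟩ := bJ_deriv n (α' * r / R)
      have := ((hp.comp r (l α)).mul (hj'.comp r (l α'))).sub
        ((hj.comp r (l α)).mul (hp'.comp r (l α')))
      refine HasDerivAt.congr_deriv this ?_
      apply mul_left_cancel₀ hr0
      simp only [Function.comp_apply]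
      generalize besselJ n (α * r / R) = A at *
      generalize besselJ n (α' * r / R) = B at *
      generalize bP n (α * r / R) = C at *
      generalize bP n (α' * r / R) = D at *
      linear_combination B * ep - A * ep' + C * ej' - D * ej) (by
      apply Continuous.intervalIntegrable; fun_prop)
  rw [intervalIntegral.integral_const_mul] at main
  have hRR : ∀ β : ℝ, β * R / R = β := fun β => by field_simp
  simp only [hRR, Pα, Pα', mul_zero, zero_div, P0, zero_mul, sub_zero] at main
  refine (mul_eq_zero.mp main).resolve_left ?_
  apply div_ne_zero _ (by positivity)
  intro h
  have : (α' - α) * (α' + α) = 0 := by linarith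
  rcases mul_eq_zero.mp this with h | h
  · exact hne (by linarith)
  · linarith

lemma b_angular (k : ℤ) (hk : k ≠ 0) (c : ℂ) :
    ∫ θ in (0 : ℝ)..(2 * Real.pi), c * Complex.exp (Complex.I * ((k : ℂ) * θ)) = 0 := by
  have e : ∀ θ : ℝ, Complex.I * ((k : ℂ) * θ) = (Complex.I * k) * θ := fun θ => by ring
  simp only [e]
  rw [intervalIntegral.integral_const_mul, integral_exp_mul_complex
    (mul_ne_zero Complex.I_ne_zero (by exact_mod_cast hk))]
  have : Complex.I * k * ((2 * Real.pi : ℝ) : ℂ) = k * (2 * Real.pi * Complex.I) := by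
    push_cast; ring
  rw [this, Complex.exp_int_mul_two_pi_mul_I]
  simp

/-- Orthogonality (with weight `r`) of the complex eigenfunctions
`φ^c_{n,α}(r,θ) = J_n(αr/R) e^{inθ}` and their conjugates on `[0,R] × [0,2π]`:
if `(n,α) ≠ (n',α')` then `⟨φ^c_{n,α}, φ^c_{n',α'}⟩ = 0`, and if `n + n' ≥ 1` then
`⟨φ^c_{n,α}, φ^s_{n',α'}⟩ = 0`. -/
theorem besselJ_complex_eigenfunctions_orthogonal (R : ℝ) (hR : 0 < R)
    (n n' : ℕ) (α α' : ℝ) (hα : 0 < α) (hα' : 0 < α')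
    (h1 : deriv (besselJ n) α = 0) (h2 : deriv (besselJ n') α' = 0) :
    ((n, α) ≠ (n', α') →
      (∫ r in (0 : ℝ)..R, ∫ θ in (0 : ℝ)..(2 * Real.pi),
        (r : ℂ) * (besselJ n (α * r / R) : ℝ) * (besselJ n' (α' * r / R) : ℝ)
          * Complex.exp (Complex.I * (((n : ℝ) - (n' : ℝ)) * θ))) = 0) ∧
    (1 ≤ n + n' →
      (∫ r in (0 : ℝ)..R, ∫ θ in (0 : ℝ)..(2 * Real.pi),
        (r : ℂ) * (besselJ n (α * r / R) : ℝ) * (besselJ n' (α' * r / R) : ℝ)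
          * Complex.exp (Complex.I * (((n : ℝ) + (n' : ℝ)) * θ))) = 0) := by
  constructor
  · intro hne
    by_cases hn : n = n'
    · subst hn
      have hαα : α ≠ α' := fun h => hne (by rw [h])
      have := b_radial R hR n α α' hα hα' h1 h2 hαα
      simp only [sub_self, zero_mul, mul_zero, Complex.exp_zero, mul_one,
        intervalIntegral.integral_const, sub_zero]
      rw [intervalIntegral.integral_smul]
      have e : ∀ r : ℝ, (r : ℂ) * (besselJ n (α * r / R) : ℝ) * (besselJ n (α' * r / R) : ℝ)
        = ((r * besselJ n (α * r / R) * besselJ n (α' * r / R) : ℝ) : ℂ) := by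
        intro r; push_cast; rfl
      simp only [e]
      rw [intervalIntegral.integral_ofReal, this]
      simp
    · have := b_angular ((n : ℤ) - n') (by omega)
      push_cast at this ⊢
      simp [this]
  · intro hn
    have := b_angular ((n : ℤ) + n') (by omega)
    push_cast at this ⊢
    simp [this]
end
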